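/- arXiv:2211.10874 — 2 statements merged into one kernel-verified Lean document; each statement's English description precedes it below -/
import Mathlib

section
/- Let n ≥ 2 and let m = (m_1,…,m_n) satisfy m_1 ≥ m_2 ≥ … ≥ m_n > 0. Let Σ = (σ_1,…,σ_N) be a symbolic collision sequence with parameters ρ_1,…,ρ_N > 0, and let D = D_{(i_N,ρ_N)} ∘ ⋯ ∘ D_{(i_1,ρ_1)} be the corresponding composition of collision maps. Then Q_1(D x) ≥ Q_1(x) for every x ∈ ℝ^n × ℝ^n; consequently D maps the cone C_1 = {Q_1 ≥ 0} into itself. -/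
open Matrix BigOperators

/-- `γ_i = (m_i - m_{i+1})/(m_i + m_{i+1})` (masses indexed 1-based). -/
noncomputable def gammaC (m : ℕ → ℝ) (i : ℕ) : ℝ := (m i - m (i + 1)) / (m i + m (i + 1))

/-- `α_i(ρ) = 2 m_i m_{i+1} (m_i - m_{i+1}) ρ / (m_i + m_{i+1})²`. -/
noncomputable def alphaC (m : ℕ → ℝ) (i : ℕ) (ρ : ℝ) : ℝ :=
  2 * m i * m (i + 1) * (m i - m (i + 1)) * ρ / (m i + m (i + 1)) ^ 2

/-- The collision matrix `R_i` (1 ≤ i ≤ n-1); particles are 1-based, so particle `i`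
has 0-based index `i - 1` (i.e. `a : Fin n` with `a + 1 = i`).  `R_0 = I`. -/
noncomputable def Rmat (n : ℕ) (m : ℕ → ℝ) (i : ℕ) : Matrix (Fin n) (Fin n) ℝ :=
  if i = 0 then 1 else
    Matrix.of fun a b =>
      if (a : ℕ) + 1 = i ∧ (b : ℕ) + 1 = i then gammaC m i
      else if (a : ℕ) + 1 = i ∧ (b : ℕ) = i then 1 - gammaC m i
      else if (a : ℕ) = i ∧ (b : ℕ) + 1 = i then 1 + gammaC m i
      else if (a : ℕ) = i ∧ (b : ℕ) = i then -(gammaC m i)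
      else if a = b then 1 else 0

/-- The matrix `S_i(ρ)` (zero unless 1 ≤ i ≤ n-1). -/
noncomputable def Smat (n : ℕ) (m : ℕ → ℝ) (i : ℕ) (ρ : ℝ) : Matrix (Fin n) (Fin n) ℝ :=
  if i = 0 then 0 else
    Matrix.of fun a b =>
      if (a : ℕ) + 1 = i ∧ (b : ℕ) + 1 = i then alphaC m i ρ
      else if (a : ℕ) + 1 = i ∧ (b : ℕ) = i then -(alphaC m i ρ)
      else if (a : ℕ) = i ∧ (b : ℕ) + 1 = i then -(alphaC m i ρ)
      else if (a : ℕ) = i ∧ (b : ℕ) = i then alphaC m i ρ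
      else 0

/-- The quadratic form `Q₁(δh, δv) = Σ_j δh_j δv_j`. -/
noncomputable def Qform (n : ℕ) (x : (Fin n → ℝ) × (Fin n → ℝ)) : ℝ :=
  ∑ j, x.1 j * x.2 j

/-- The collision map `D_{(i,ρ)}`: floor collision when `i = 0`,
ball-to-ball collision `(i, i+1)` when `1 ≤ i ≤ n-1`. -/
noncomputable def Dmap (n : ℕ) (m : ℕ → ℝ) (i : ℕ) (ρ : ℝ)
    (x : (Fin n → ℝ) × (Fin n → ℝ)) : (Fin n → ℝ) × (Fin n → ℝ) :=
  if i = 0 then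
    (x.1, fun j => x.2 j + if (j : ℕ) = 0 then 2 * x.1 j / (m 1 * ρ) else 0)
  else
    ((Rmat n m i)ᵀ *ᵥ (x.1 + Smat n m i ρ *ᵥ x.2), Rmat n m i *ᵥ x.2)

/-- Composition `D_{(i_N,ρ_N)} ∘ ⋯ ∘ D_{(i_1,ρ_1)}` along an extended symbolic sequence,
given as the list `[(i_1,ρ_1), …, (i_N,ρ_N)]`. -/
noncomputable def Dcomp (n : ℕ) (m : ℕ → ℝ) :
    List (ℕ × ℝ) → ((Fin n → ℝ) × (Fin n → ℝ)) → ((Fin n → ℝ) × (Fin n → ℝ))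
  | [], x => x
  | c :: rest, x => Dcomp n m rest (Dmap n m c.1 c.2 x)

/-- `Rprod [i_1, …, i_k] = R_{i_k}ᵀ ⋯ R_{i_2}ᵀ R_{i_1}ᵀ`. -/
noncomputable def Rprod (n : ℕ) (m : ℕ → ℝ) : List ℕ → Matrix (Fin n) (Fin n) ℝ
  | [] => 1
  | i :: rest => Rprod n m rest * (Rmat n m i)ᵀ

/-- The neutral space `N(Σ, m)`: vectors `δh` with `Σ_j δh_j = 0` such that for every
prefix of `Σ` ending with a floor collision, the first entry of the corresponding
product `R_{i_k}ᵀ ⋯ R_{i_1}ᵀ δh` vanishes. -/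
noncomputable def NeutralSpace (n : ℕ) (m : ℕ → ℝ) (Sl : List ℕ) : Set (Fin n → ℝ) :=
  {δh | (∑ j, δh j) = 0 ∧
    ∀ p : List ℕ, p <+: Sl → p.getLast? = some 0 →
      ∀ a : Fin n, (a : ℕ) = 0 → (Rprod n m p *ᵥ δh) a = 0}

/-- An admissible mass vector: `m_1 > m_2 > … > m_n > 0` (1-based indexing). -/
def Admissible (n : ℕ) (m : ℕ → ℝ) : Prop :=
  (∀ i : ℕ, 1 ≤ i → i < n → m (i + 1) < m i) ∧ 0 < m n

/-- Away from the floor, `R_i` is a rank-one perturbation of the identity. -/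
lemma Rmat_eq_one_sub_vecMulVec {n : ℕ} (m : ℕ → ℝ) (p q : Fin n) (hpq : (p : ℕ) + 1 = q) :
    Rmat n m q = 1 - vecMulVec
      ((1 - gammaC m q) • Pi.single p (1 : ℝ) - (1 + gammaC m q) • Pi.single q (1 : ℝ))
      (Pi.single p (1 : ℝ) - Pi.single q (1 : ℝ)) := by
  have hq : (q : ℕ) ≠ 0 := by omega
  ext a b
  simp only [Rmat, if_neg hq, of_apply, Matrix.sub_apply, one_apply, vecMulVec_apply,
    Pi.sub_apply, Pi.smul_apply, Pi.single_apply, smul_eq_mul, Fin.ext_iff]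
  split_ifs <;> first | omega | ring

/-- Away from the floor, `S_i(ρ)` is a multiple of a rank-one symmetric matrix. -/
lemma Smat_eq_smul_vecMulVec {n : ℕ} (m : ℕ → ℝ) (ρ : ℝ) (p q : Fin n)
    (hpq : (p : ℕ) + 1 = q) :
    Smat n m q ρ = alphaC m q ρ • vecMulVec
      (Pi.single p (1 : ℝ) - Pi.single q (1 : ℝ)) (Pi.single p (1 : ℝ) - Pi.single q (1 : ℝ)) := by
  have hq : (q : ℕ) ≠ 0 := by omega
  ext a b
  simp only [Smat, if_neg hq, of_apply, Matrix.smul_apply, vecMulVec_apply,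
    Pi.sub_apply, Pi.single_apply, smul_eq_mul, Fin.ext_iff]
  split_ifs <;> first | omega | ring

/-- The collision matrix is an involution. -/
lemma Rmat_mul_self {n : ℕ} (m : ℕ → ℝ) (p q : Fin n) (hpq : (p : ℕ) + 1 = q) :
    Rmat n m q * Rmat n m q = 1 := by
  have hne : p ≠ q := by rintro rfl; omega
  have hdot : (Pi.single p (1 : ℝ) - Pi.single q (1 : ℝ)) ⬝ᵥ
      ((1 - gammaC m q) • Pi.single p (1 : ℝ) - (1 + gammaC m q) • Pi.single q (1 : ℝ)) = 2 := by
    simp [hne, hne.symm]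
    ring
  rw [Rmat_eq_one_sub_vecMulVec m p q hpq, sub_mul, mul_sub, mul_sub, vecMulVec_mul_vecMulVec,
    hdot, vecMulVec_smul]
  simp only [one_mul, mul_one]
  module

lemma Qform_Dmap_of_ne_zero {n : ℕ} (m : ℕ → ℝ) (ρ : ℝ) (p q : Fin n) (hpq : (p : ℕ) + 1 = q)
    (x : (Fin n → ℝ) × (Fin n → ℝ)) :
    Qform n (Dmap n m q ρ x) = Qform n x + alphaC m q ρ * (x.2 p - x.2 q) ^ 2 := by
  have hq : (q : ℕ) ≠ 0 := by omega
  change (Dmap n m q ρ x).1 ⬝ᵥ (Dmap n m q ρ x).2 = x.1 ⬝ᵥ x.2 + _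
  rw [Dmap, if_neg hq]
  dsimp only
  rw [mulVec_transpose, ← dotProduct_mulVec, mulVec_mulVec, Rmat_mul_self m p q hpq, one_mulVec,
    add_dotProduct, Smat_eq_smul_vecMulVec m ρ p q hpq, smul_mulVec, vecMulVec_mulVec]
  simp [sub_dotProduct]
  exact Or.inl (by ring)

lemma Qform_le_Qform_Dmap_zero {n : ℕ} (m : ℕ → ℝ) (ρ : ℝ) (hm : 0 ≤ m 1) (hρ : 0 ≤ ρ)
    (x : (Fin n → ℝ) × (Fin n → ℝ)) : Qform n x ≤ Qform n (Dmap n m 0 ρ x) := by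
  simp only [Qform, Dmap, if_true]
  refine Finset.sum_le_sum fun j _ => ?_
  split_ifs
  · have : 0 ≤ 2 * x.1 j ^ 2 / (m 1 * ρ) := by positivity
    calc x.1 j * x.2 j ≤ x.1 j * x.2 j + 2 * x.1 j ^ 2 / (m 1 * ρ) := by linarith
      _ = x.1 j * (x.2 j + 2 * x.1 j / (m 1 * ρ)) := by ring
  · simp

lemma alphaC_nonneg {m : ℕ → ℝ} {i : ℕ} {ρ : ℝ} (hi : 0 ≤ m (i + 1)) (h : m (i + 1) ≤ m i)
    (hρ : 0 ≤ ρ) : 0 ≤ alphaC m i ρ := by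
  have := hi.trans h
  have := sub_nonneg.2 h
  unfold alphaC
  positivity

lemma Qform_le_Qform_Dmap {n : ℕ} {m : ℕ → ℝ} (hn : 0 < n)
    (hmono : ∀ i : ℕ, 1 ≤ i → i < n → m (i + 1) ≤ m i) (hpos : 0 ≤ m n)
    {i : ℕ} (hi : i < n) {ρ : ℝ} (hρ : 0 ≤ ρ) (x : (Fin n → ℝ) × (Fin n → ℝ)) :
    Qform n x ≤ Qform n (Dmap n m i ρ x) := by
  have hm : ∀ j ≤ n, 1 ≤ j → 0 ≤ m j := fun j hj =>
    Nat.decreasingInduction (motive := fun j _ => 1 ≤ j → 0 ≤ m j)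
      (fun k hk ih h1 => (ih (by omega)).trans (hmono k h1 hk)) (fun _ => hpos) hj
  rcases Nat.eq_zero_or_pos i with rfl | h0
  · exact Qform_le_Qform_Dmap_zero m ρ (hm 1 hn le_rfl) hρ x
  · have hQ := Qform_Dmap_of_ne_zero m ρ ⟨i - 1, by omega⟩ ⟨i, hi⟩ (Nat.sub_add_cancel h0) x
    have hα := alphaC_nonneg (hm (i + 1) hi (by omega)) (hmono i h0 hi) hρ
    rw [hQ]
    exact le_add_of_nonneg_right (mul_nonneg hα (sq_nonneg _))

/-- For nonincreasing masses `m_1 ≥ … ≥ m_n > 0`, the composition of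
collision maps along any symbolic collision sequence does not decrease `Q₁`;
consequently it maps the cone `C₁ = {Q₁ ≥ 0}` into itself. -/
theorem cone_invariance (n : ℕ) (hn : 2 ≤ n) (m : ℕ → ℝ)
    (hmono : ∀ i : ℕ, 1 ≤ i → i < n → m (i + 1) ≤ m i) (hpos : 0 < m n)
    (L : List (ℕ × ℝ)) (hL : ∀ c ∈ L, c.1 ≤ n - 1 ∧ 0 < c.2) :
    (∀ x : (Fin n → ℝ) × (Fin n → ℝ), Qform n x ≤ Qform n (Dcomp n m L x)) ∧
      ∀ x : (Fin n → ℝ) × (Fin n → ℝ), 0 ≤ Qform n x → 0 ≤ Qform n (Dcomp n m L x) := by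
  have hle : ∀ x : (Fin n → ℝ) × (Fin n → ℝ), Qform n x ≤ Qform n (Dcomp n m L x) := by
    induction L with
    | nil => exact fun x => le_rfl
    | cons c rest ih =>
      intro x
      obtain ⟨hc, hρ⟩ := hL c List.mem_cons_self
      exact (Qform_le_Qform_Dmap (by omega) hmono hpos.le (by omega) hρ.le x).trans
        (ih (fun d hd => hL d (List.mem_cons_of_mem _ hd)) _)
  exact ⟨hle, fun x hx => hx.trans (hle x)⟩
end

section
/- (Dichotomy.) Let n ≥ 2 and let Σ = (σ_1,…,σ_N) be a symbolic collision sequence. Then exactly one of the following holds: (D1) there exists a nonzero polynomial P ∈ ℝ[x_1,…,x_n] such that N(Σ, m) = {0} for every admissible mass vector m (i.e. m_1 > m_2 > … > m_n > 0) with P(m) ≠ 0; or (D2) N(Σ, m) ≠ {0} for every admissible mass vector m. -/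
open Matrix BigOperators

/-- Evaluation of a polynomial at the masses `(m_1, …, m_n)`. -/
noncomputable def massEval (n : ℕ) (m : ℕ → ℝ) : MvPolynomial (Fin n) ℝ →+* ℝ :=
  MvPolynomial.eval fun j : Fin n => m ((j : ℕ) + 1)

/-- The functions of the masses which agree on all admissible mass vectors with a rational
function whose denominator does not vanish there. -/
noncomputable def massRational (n : ℕ) : Subring ((ℕ → ℝ) → ℝ) where
  carrier := {f | ∃ P Q : MvPolynomial (Fin n) ℝ, ∀ m, Admissible n m →
    massEval n m Q ≠ 0 ∧ f m * massEval n m Q = massEval n m P}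
  zero_mem' := ⟨0, 1, fun m _ => by simp⟩
  one_mem' := ⟨1, 1, fun m _ => by simp⟩
  neg_mem' := by
    rintro f ⟨P, Q, h⟩
    refine ⟨-P, Q, fun m hm => ⟨(h m hm).1, ?_⟩⟩
    rw [map_neg, ← (h m hm).2, Pi.neg_apply, neg_mul]
  add_mem' := by
    rintro f g ⟨P, Q, h⟩ ⟨P', Q', h'⟩
    refine ⟨P * Q' + P' * Q, Q * Q', fun m hm => ⟨?_, ?_⟩⟩
    · rw [map_mul]
      exact mul_ne_zero (h m hm).1 (h' m hm).1
    · simp only [map_add, map_mul, ← (h m hm).2, ← (h' m hm).2, Pi.add_apply]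
      ring
  mul_mem' := by
    rintro f g ⟨P, Q, h⟩ ⟨P', Q', h'⟩
    refine ⟨P * P', Q * Q', fun m hm => ⟨?_, ?_⟩⟩
    · rw [map_mul]
      exact mul_ne_zero (h m hm).1 (h' m hm).1
    · simp only [map_mul, ← (h m hm).2, ← (h' m hm).2, Pi.mul_apply]
      ring

theorem Admissible.pos {n : ℕ} {m : ℕ → ℝ} (hm : Admissible n m) {i : ℕ} (hi : 1 ≤ i)
    (hin : i ≤ n) : 0 < m i := by
  induction hin using Nat.decreasingInduction with
  | self => exact hm.2
  | of_succ k hk ih => exact (ih (by omega)).trans (hm.1 k hi hk)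

theorem gammaC_mem_massRational {n i : ℕ} (hi : 1 ≤ i) (hin : i < n) :
    (fun m => gammaC m i) ∈ massRational n := by
  let a : MvPolynomial (Fin n) ℝ := .X ⟨i - 1, by omega⟩
  let b : MvPolynomial (Fin n) ℝ := .X ⟨i, hin⟩
  refine ⟨a - b, a + b, fun m hm => ?_⟩
  have ha : massEval n m a = m i := by simp [massEval, a, Nat.sub_add_cancel hi]
  have hb : massEval n m b = m (i + 1) := by simp [massEval, b]
  have hne : m i + m (i + 1) ≠ 0 :=
    (add_pos (hm.pos hi hin.le) (hm.pos (Nat.le_add_left 1 i) hin)).ne'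
  rw [map_add, map_sub, ha, hb]
  exact ⟨hne, div_mul_cancel₀ _ hne⟩

theorem Rmat_mem_massRational {n i : ℕ} (hin : i ≤ n - 1) (a b : Fin n) :
    (fun m => Rmat n m i a b) ∈ massRational n := by
  by_cases hi : i = 0
  · simp only [Rmat, if_pos hi, Matrix.one_apply]
    split_ifs
    · exact one_mem _
    · exact zero_mem _
  have hg := gammaC_mem_massRational (n := n) (Nat.one_le_iff_ne_zero.2 hi)
    (by have := a.isLt; omega)
  simp only [Rmat, if_neg hi, Matrix.of_apply]
  split_ifs
  · exact hg
  · exact sub_mem (one_mem _) hg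
  · exact add_mem (one_mem _) hg
  · exact neg_mem hg
  · exact one_mem _
  · exact zero_mem _

theorem Matrix.mul_apply_mem {X ι κ μ : Type*} [Fintype κ] {S : Subring (X → ℝ)}
    {A : X → Matrix ι κ ℝ} {B : X → Matrix κ μ ℝ} (hA : ∀ a b, (fun x => A x a b) ∈ S)
    (hB : ∀ a b, (fun x => B x a b) ∈ S) (a : ι) (b : μ) : (fun x => (A x * B x) a b) ∈ S := by
  have : (fun x => (A x * B x) a b) = ∑ k, (fun x => A x a k) * fun x => B x k b := by
    ext x
    simp [Matrix.mul_apply]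
  rw [this]
  exact sum_mem fun k _ => mul_mem (hA a k) (hB k b)

theorem Matrix.det_mem {X ι : Type*} [Fintype ι] [DecidableEq ι] {S : Subring (X → ℝ)}
    {A : X → Matrix ι ι ℝ} (hA : ∀ a b, (fun x => A x a b) ∈ S) : (fun x => (A x).det) ∈ S := by
  have : (fun x => (A x).det) =
      ∑ σ : Equiv.Perm ι, (σ.sign : ℤ) • ∏ i, fun x => A x (σ i) i := by
    ext x
    simp [Matrix.det_apply, Units.smul_def]
  rw [this]
  exact sum_mem fun σ _ => zsmul_mem (prod_mem fun i _ => hA (σ i) i) _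

theorem Rprod_mem_massRational {n : ℕ} {p : List ℕ} (hp : ∀ i ∈ p, i ≤ n - 1) (a b : Fin n) :
    (fun m => Rprod n m p a b) ∈ massRational n := by
  induction p generalizing a b with
  | nil =>
    simp only [Rprod, Matrix.one_apply]
    split_ifs
    · exact one_mem _
    · exact zero_mem _
  | cons i p ih =>
    exact Matrix.mul_apply_mem (ih fun j hj => hp j (List.mem_cons_of_mem _ hj))
      (fun a b => Rmat_mem_massRational (hp i List.mem_cons_self) b a) a b

/-- A matrix whose kernel is the neutral space: a prefix ending with a floor collision contributes
the first row of its product, every other prefix the all-ones row. -/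
noncomputable def neutralMatrix (n : ℕ) [NeZero n] (m : ℕ → ℝ) (Sl : List ℕ) :
    Matrix (Fin (Sl.length + 1)) (Fin n) ℝ :=
  Matrix.of fun k b =>
    if (Sl.take k).getLast? = some 0 then Rprod n m (Sl.take k) 0 b else 1

theorem mem_NeutralSpace_iff {n : ℕ} [NeZero n] {m : ℕ → ℝ} {Sl : List ℕ} {v : Fin n → ℝ} :
    v ∈ NeutralSpace n m Sl ↔ neutralMatrix n m Sl *ᵥ v = 0 := by
  have row (k : Fin (Sl.length + 1)) : (neutralMatrix n m Sl *ᵥ v) k =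
      if (Sl.take k).getLast? = some 0 then (Rprod n m (Sl.take k) *ᵥ v) 0 else ∑ j, v j := by
    simp only [neutralMatrix, Matrix.mulVec, dotProduct, Matrix.of_apply]
    split_ifs <;> simp
  constructor
  · rintro ⟨hsum, hfloor⟩
    ext k
    rw [row]
    split_ifs with h
    · exact hfloor _ (List.take_prefix _ _) h 0 rfl
    · exact hsum
  · intro h
    refine ⟨by simpa [row] using congrFun h 0, fun p hp hlast a ha => ?_⟩
    have hk := congrFun h ⟨p.length, Nat.lt_succ_of_le hp.length_le⟩
    rw [row, ← List.prefix_iff_eq_take.1 hp, if_pos hlast] at hk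
    rwa [show a = 0 from Fin.ext ha]

theorem NeutralSpace_eq_singleton_zero_iff {n : ℕ} [NeZero n] {m : ℕ → ℝ} {Sl : List ℕ} :
    NeutralSpace n m Sl = {0} ↔
      ((neutralMatrix n m Sl)ᵀ * neutralMatrix n m Sl).det ≠ 0 := by
  have hker (v : Fin n → ℝ) : ((neutralMatrix n m Sl)ᵀ * neutralMatrix n m Sl) *ᵥ v = 0 ↔
      v ∈ NeutralSpace n m Sl := by
    rw [mem_NeutralSpace_iff]
    simpa using Matrix.conjTranspose_mul_self_mulVec_eq_zero (neutralMatrix n m Sl) v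
  rw [Ne, ← Matrix.exists_mulVec_eq_zero_iff, Set.eq_singleton_iff_unique_mem]
  simp only [hker]
  constructor
  · rintro ⟨-, h⟩ ⟨v, hv, hv'⟩
    exact hv (h v hv')
  · intro h
    refine ⟨mem_NeutralSpace_iff.2 (Matrix.mulVec_zero _), fun v hv => ?_⟩
    by_contra hne
    exact h ⟨v, hne, hv⟩

theorem exists_admissible_massEval_ne_zero {n : ℕ} (hn : 1 ≤ n) {P : MvPolynomial (Fin n) ℝ}
    (hP : P ≠ 0) : ∃ m, Admissible n m ∧ massEval n m P ≠ 0 := by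
  by_contra! h
  let s : Fin n → Set ℝ := fun j => Set.Ioo ((n : ℝ) - j - 1) (n - j)
  have hs (j : Fin n) : (s j).Infinite := Set.Ioo_infinite (by linarith)
  refine hP (MvPolynomial.funext_set s hs fun x hx => ?_)
  have hx (j : Fin n) : x j ∈ s j := hx j (Set.mem_univ j)
  let m : ℕ → ℝ := fun k => if hk : k - 1 < n then x ⟨k - 1, hk⟩ else 0
  have hmx : (fun j : Fin n => m (j + 1)) = x := by
    ext j
    simp [m]
  have hm : Admissible n m := by
    constructor
    · intro i hi hin
      have h1 := (hx ⟨i - 1, by omega⟩).1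
      have h2 := (hx ⟨i, hin⟩).2
      simp only [Nat.cast_sub hi, Nat.cast_one] at h1 h2
      simp only [m, Nat.add_sub_cancel, dif_pos hin, dif_pos (show i - 1 < n by omega)]
      linarith
    · have h1 := (hx ⟨n - 1, by omega⟩).1
      simp only [Nat.cast_sub hn, Nat.cast_one] at h1
      simp only [m, dif_pos (show n - 1 < n by omega)]
      linarith
  simpa [massEval, hmx] using h m hm

/-- **Dichotomy.** For any symbolic collision sequence `Σ`, exactly one of:
(D1) there is a nonzero polynomial `P` in the masses such that `N(Σ, m) = {0}` for every
admissible mass vector with `P(m) ≠ 0`; or (D2) `N(Σ, m) ≠ {0}` for every admissible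
mass vector. -/
theorem dichotomy (n : ℕ) (hn : 2 ≤ n) (Sl : List ℕ) (hS : ∀ i ∈ Sl, i ≤ n - 1) :
    Xor'
      (∃ P : MvPolynomial (Fin n) ℝ, P ≠ 0 ∧
        ∀ m : ℕ → ℝ, Admissible n m →
          MvPolynomial.eval (fun j : Fin n => m ((j : ℕ) + 1)) P ≠ 0 →
            NeutralSpace n m Sl = {0})
      (∀ m : ℕ → ℝ, Admissible n m → NeutralSpace n m Sl ≠ {0}) := by
  have : NeZero n := ⟨by omega⟩
  have hentry (k : Fin (Sl.length + 1)) (b : Fin n) :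
      (fun m => neutralMatrix n m Sl k b) ∈ massRational n := by
    simp only [neutralMatrix, Matrix.of_apply]
    split_ifs
    · exact Rprod_mem_massRational (fun i hi => hS i (List.mem_of_mem_take hi)) 0 b
    · exact one_mem _
  obtain ⟨P, Q, hPQ⟩ := Matrix.det_mem (Matrix.mul_apply_mem
    (A := fun m => (neutralMatrix n m Sl)ᵀ) (fun a b => hentry b a) hentry)
  refine (xor_iff_or_and_not_and _ _).2 ?_
  constructor
  · by_cases hP : P = 0
    · refine .inr fun m hm => ?_
      obtain ⟨hQ, hdet⟩ := hPQ m hm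
      rw [hP, map_zero] at hdet
      rw [Ne, NeutralSpace_eq_singleton_zero_iff, not_not]
      exact (mul_eq_zero.1 hdet).resolve_right hQ
    · refine .inl ⟨P, hP, fun m hm hPm => NeutralSpace_eq_singleton_zero_iff.2 fun h0 => hPm ?_⟩
      have hdet := (hPQ m hm).2
      simp only [h0, zero_mul] at hdet
      exact hdet.symm
  · rintro ⟨⟨P', hP', h1⟩, h2⟩
    obtain ⟨m, hm, hne⟩ := exists_admissible_massEval_ne_zero (by omega) hP'
    exact h2 m hm (h1 m hm hne)
end
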